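/- Let d ≥ 2, let U ⊂ ℝ^d be open and bounded, let r > 0, and let (U)^r be the interior of the union of all cubes in the tessellation 𝒬_r = {x + r[-1/2,1/2)^d : x ∈ rℤ^d} that intersect U; assume (U)^r is connected. Then there is an absolute constant C > 0 (independent of U and r) such that for every v ∈ H¹((U)^r; ℝ^d) there exists b ∈ ℝ^d with r^{-2} ∫_{(U)^r} |v(x) - b|² dx ≤ C (#𝒬_r(U))² ∫_{(U)^r} |∇v|² dx, where #𝒬_r(U) is the number of tessellation cubes intersecting U. -/

import Mathlib

open Set MeasureTheory

/-- The half-open cube of sidelength `r` centered at `r·z`, `z ∈ ℤ^d`. -/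
def smallCube (d : ℕ) (r : ℝ) (z : Fin d → ℤ) : Set (EuclideanSpace ℝ (Fin d)) :=
  {x | ∀ i, r * (z i : ℝ) - r/2 ≤ x i ∧ x i < r * (z i : ℝ) + r/2}

/-- The `r`-cubic set `(U)^r`: the interior of the union of the closures of all tessellation
cubes meeting `U`. -/
def cubicSet (d : ℕ) (r : ℝ) (U : Set (EuclideanSpace ℝ (Fin d))) :
    Set (EuclideanSpace ℝ (Fin d)) :=
  interior (⋃ z ∈ {z : Fin d → ℤ | (smallCube d r z ∩ U).Nonempty}, closure (smallCube d r z))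

/-- The number `#𝒬_r(U)` of tessellation cubes meeting `U`. -/
noncomputable def numCubes (d : ℕ) (r : ℝ) (U : Set (EuclideanSpace ℝ (Fin d))) : ℕ :=
  Nat.card {z : Fin d → ℤ // (smallCube d r z ∩ U).Nonempty}

open scoped ENNReal

theorem sq_lintegral_le_lintegral_sq {α : Type*} [MeasurableSpace α] (μ : Measure α)
    [IsProbabilityMeasure μ] {f : α → ℝ≥0∞} (hf : AEMeasurable f μ) :
    (∫⁻ a, f a ∂μ) ^ 2 ≤ ∫⁻ a, f a ^ 2 ∂μ := by
  have h := ENNReal.lintegral_mul_le_Lp_mul_Lq μ Real.HolderConjugate.two_two hf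
    (aemeasurable_const (b := (1 : ℝ≥0∞)))
  simp only [Pi.mul_apply, mul_one, lintegral_const, measure_univ, ENNReal.rpow_two,
    one_pow, ENNReal.one_rpow] at h
  calc (∫⁻ a, f a ∂μ) ^ 2 ≤ ((∫⁻ a, f a ^ 2 ∂μ) ^ (1 / 2 : ℝ)) ^ 2 := by gcongr
    _ = ∫⁻ a, f a ^ 2 ∂μ := by
      rw [← ENNReal.rpow_two, ← ENNReal.rpow_mul]; norm_num

/-- For a function differentiable along a segment, with no continuity assumption on the derivative,
the squared increment is bounded by the squared length times the integral of the squared norm of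
the derivative. -/
theorem enorm_sub_sq_le_lintegral_segment {E F : Type*} [NormedAddCommGroup E] [NormedSpace ℝ E]
    [MeasurableSpace E] [BorelSpace E] [NormedAddCommGroup F] [NormedSpace ℝ F] [CompleteSpace F]
    [SecondCountableTopology F] {v : E → F} {x y : E}
    (hv : ∀ t ∈ Icc (0 : ℝ) 1, DifferentiableAt ℝ v ((1 - t) • x + t • y)) :
    ‖v y - v x‖ₑ ^ 2 ≤
      ‖y - x‖ₑ ^ 2 * ∫⁻ t in Icc (0 : ℝ) 1, ‖fderiv ℝ v ((1 - t) • x + t • y)‖ₑ ^ 2 := by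
  borelize F
  rcases eq_or_ne y x with rfl | hxy
  · simp
  set γ : ℝ → E := fun t => (1 - t) • x + t • y with hγ
  have hγc : Continuous γ := by fun_prop
  have hγd : ∀ t, HasDerivAt γ (y - x) t := by
    intro t
    have h1 : HasDerivAt (fun t : ℝ => 1 - t) (-1) t := by
      simpa using (hasDerivAt_id t).const_sub 1
    have h := (h1.smul_const x).fun_add ((hasDerivAt_id' t).smul_const y)
    rwa [neg_one_smul, one_smul, neg_add_eq_sub] at h
  set I := ∫⁻ t in Icc (0 : ℝ) 1, ‖fderiv ℝ v (γ t)‖ₑ ^ 2 with hI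
  by_cases hfin : I = ∞
  · rw [hfin, ENNReal.mul_top]
    · exact le_top
    · simpa [sub_eq_zero] using hxy
  have : IsProbabilityMeasure (volume.restrict (Icc (0 : ℝ) 1)) := ⟨by simp⟩
  have hfm : Measurable fun t => ‖fderiv ℝ v (γ t)‖ₑ :=
    ((measurable_fderiv ℝ v).comp hγc.measurable).enorm
  have hsq := sq_lintegral_le_lintegral_sq (volume.restrict (Icc (0 : ℝ) 1)) hfm.aemeasurable
  have hlt : ∫⁻ t in Icc (0 : ℝ) 1, ‖fderiv ℝ v (γ t)‖ₑ < ∞ := by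
    by_contra hcon
    rw [not_lt, top_le_iff] at hcon
    rw [hcon] at hsq
    simp only [ne_eq, OfNat.ofNat_ne_zero, not_false_eq_true, ENNReal.top_pow, top_le_iff] at hsq
    exact hfin hsq
  have hle : ∫⁻ t in Icc (0 : ℝ) 1, ‖fderiv ℝ v (γ t) (y - x)‖ₑ ≤
      (∫⁻ t in Icc (0 : ℝ) 1, ‖fderiv ℝ v (γ t)‖ₑ) * ‖y - x‖ₑ := by
    rw [← lintegral_mul_const _ hfm]
    exact lintegral_mono fun t => ContinuousLinearMap.le_opENorm _ _
  have hmeas : Measurable fun t => fderiv ℝ v (γ t) (y - x) :=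
    (measurable_fderiv_apply_const ℝ v (y - x)).comp hγc.measurable
  have hint : IntegrableOn (fun t => fderiv ℝ v (γ t) (y - x)) (Icc 0 1) :=
    ⟨hmeas.aestronglyMeasurable, hle.trans_lt (ENNReal.mul_lt_top hlt enorm_lt_top)⟩
  have hftc : ∫ t in (0 : ℝ)..1, fderiv ℝ v (γ t) (y - x) = v (γ 1) - v (γ 0) := by
    refine intervalIntegral.integral_eq_sub_of_hasDerivAt (f := fun t => v (γ t)) ?_ ?_
    · intro t ht
      rw [uIcc_of_le zero_le_one] at ht
      exact (hv t ht).hasFDerivAt.comp_hasDerivAt t (hγd t)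
    · rw [intervalIntegrable_iff_integrableOn_Icc_of_le zero_le_one]
      exact hint
  rw [intervalIntegral.integral_of_le zero_le_one, ← integral_Icc_eq_integral_Ioc] at hftc
  have h01 : v y - v x = v (γ 1) - v (γ 0) := by simp [hγ]
  calc ‖v y - v x‖ₑ ^ 2
      ≤ (∫⁻ t in Icc (0 : ℝ) 1, ‖fderiv ℝ v (γ t) (y - x)‖ₑ) ^ 2 := by
        rw [h01, ← hftc]
        gcongr
        exact enorm_integral_le_lintegral_enorm _
    _ ≤ ((∫⁻ t in Icc (0 : ℝ) 1, ‖fderiv ℝ v (γ t)‖ₑ) * ‖y - x‖ₑ) ^ 2 := by gcongr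
    _ = ‖y - x‖ₑ ^ 2 * (∫⁻ t in Icc (0 : ℝ) 1, ‖fderiv ℝ v (γ t)‖ₑ) ^ 2 := by ring
    _ ≤ _ := by gcongr

theorem lintegral_comp_add_smul_le {E : Type*} [NormedAddCommGroup E] [NormedSpace ℝ E]
    [MeasurableSpace E] [BorelSpace E] [FiniteDimensional ℝ E] (μ : Measure E)
    [μ.IsAddHaarMeasure] {f : E → ℝ≥0∞} (hf : Measurable f) (p : E) {c : ℝ} (hc : 1 / 2 ≤ c) :
    ∫⁻ y, f (p + c • y) ∂μ ≤ 2 ^ Module.finrank ℝ E * ∫⁻ y, f y ∂μ := by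
  have hc0 : 0 < c := by linarith
  have hg : Measurable fun z => f (p + z) := hf.comp (measurable_const_add p)
  calc ∫⁻ y, f (p + c • y) ∂μ = ∫⁻ z, f (p + z) ∂(μ.map (c • ·)) :=
        (lintegral_map hg (measurable_const_smul c)).symm
    _ = ENNReal.ofReal |(c ^ Module.finrank ℝ E)⁻¹| * ∫⁻ y, f y ∂μ := by
        rw [Measure.map_addHaar_smul μ hc0.ne', lintegral_smul_measure,
          lintegral_add_left_eq_self, smul_eq_mul]
    _ ≤ _ := by
        gcongr
        rw [abs_of_pos (by positivity), ← inv_pow, ENNReal.ofReal_pow (inv_nonneg.2 hc0.le)]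
        gcongr
        rw [← ENNReal.ofReal_ofNat 2]
        refine ENNReal.ofReal_le_ofReal ?_
        rw [inv_le_comm₀ hc0 two_pos]
        simpa using hc

/-- Poincaré inequality on a bounded convex set, in double-integral form. -/
theorem Convex.lintegral_lintegral_enorm_sub_sq_le {E F : Type*} [NormedAddCommGroup E]
    [NormedSpace ℝ E] [MeasurableSpace E] [BorelSpace E] [FiniteDimensional ℝ E] (μ : Measure E)
    [μ.IsAddHaarMeasure] [NormedAddCommGroup F] [NormedSpace ℝ F] [CompleteSpace F]
    [SecondCountableTopology F] {v : E → F} {K : Set E} (hK : Convex ℝ K)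
    (hKm : MeasurableSet K) (hv : ∀ x ∈ K, DifferentiableAt ℝ v x) {D : ℝ≥0∞}
    (hD : ∀ x ∈ K, ∀ y ∈ K, ‖y - x‖ₑ ≤ D) :
    ∫⁻ x in K, ∫⁻ y in K, ‖v y - v x‖ₑ ^ 2 ∂μ ∂μ ≤
      D ^ 2 * 2 ^ Module.finrank ℝ E * μ K * ∫⁻ x in K, ‖fderiv ℝ v x‖ₑ ^ 2 ∂μ := by
  set g : E → ℝ≥0∞ := K.indicator fun x => ‖fderiv ℝ v x‖ₑ ^ 2 with hg
  have hgm : Measurable g := ((measurable_fderiv ℝ v).enorm.pow_const 2).indicator hKm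
  have hgint : ∫⁻ x in K, ‖fderiv ℝ v x‖ₑ ^ 2 ∂μ = ∫⁻ x, g x ∂μ :=
    (lintegral_indicator hKm _).symm
  have hmem : ∀ x ∈ K, ∀ y ∈ K, ∀ t ∈ Icc (0 : ℝ) 1, (1 - t) • x + t • y ∈ K :=
    fun x hx y hy t ht => hK hx hy (by linarith [ht.2]) ht.1 (by ring)
  have hpt : ∀ x ∈ K, ∀ y ∈ K,
      ‖v y - v x‖ₑ ^ 2 ≤ D ^ 2 * ∫⁻ t in Icc (0 : ℝ) 1, g ((1 - t) • x + t • y) := by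
    intro x hx y hy
    refine (enorm_sub_sq_le_lintegral_segment
      fun t ht => hv _ (hmem x hx y hy t ht)).trans ?_
    gcongr ?_ ^ 2 * ?_
    · exact hD x hx y hy
    · refine (setLIntegral_congr_fun measurableSet_Icc fun t ht => ?_).le
      exact (indicator_of_mem (hmem x hx y hy t ht) fun z => ‖fderiv ℝ v z‖ₑ ^ 2).symm
  have hm3 : Measurable fun q : (E × E) × ℝ => g ((1 - q.2) • q.1.1 + q.2 • q.1.2) :=
    hgm.comp (by fun_prop : Continuous fun q : (E × E) × ℝ =>
      (1 - q.2) • q.1.1 + q.2 • q.1.2).measurable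
  have hm2 : ∀ t : ℝ, Measurable fun q : E × E => g ((1 - t) • q.1 + t • q.2) := fun t =>
    hgm.comp (by fun_prop : Continuous fun q : E × E => (1 - t) • q.1 + t • q.2).measurable
  have hslice : ∀ t ∈ Icc (0 : ℝ) 1, ∫⁻ x in K, ∫⁻ y in K, g ((1 - t) • x + t • y) ∂μ ∂μ ≤
      2 ^ Module.finrank ℝ E * μ K * ∫⁻ x, g x ∂μ := by
    intro t ht
    have hconst : ∀ (h : E → ℝ≥0∞),
        (∀ x, h x ≤ 2 ^ Module.finrank ℝ E * ∫⁻ x, g x ∂μ) →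
        ∫⁻ x in K, h x ∂μ ≤ 2 ^ Module.finrank ℝ E * μ K * ∫⁻ x, g x ∂μ := by
      intro h hh
      refine (lintegral_mono hh).trans ?_
      rw [setLIntegral_const, mul_right_comm]
    rcases le_total (1 / 2) t with h | h
    · exact hconst _ fun x => (setLIntegral_le_lintegral _ _).trans
        (lintegral_comp_add_smul_le μ hgm _ h)
    · rw [lintegral_lintegral_swap (hm2 t).aemeasurable]
      refine hconst _ fun y => (setLIntegral_le_lintegral _ _).trans ?_
      simp_rw [add_comm _ (t • y)]
      exact lintegral_comp_add_smul_le μ hgm _ (by linarith)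
  calc ∫⁻ x in K, ∫⁻ y in K, ‖v y - v x‖ₑ ^ 2 ∂μ ∂μ
      ≤ ∫⁻ x in K, ∫⁻ y in K,
          D ^ 2 * (∫⁻ t in Icc (0 : ℝ) 1, g ((1 - t) • x + t • y)) ∂μ ∂μ :=
        setLIntegral_mono' hKm fun x hx => setLIntegral_mono' hKm fun y hy => hpt x hx y hy
    _ = D ^ 2 * ∫⁻ q, (∫⁻ t in Icc (0 : ℝ) 1, g ((1 - t) • q.1 + t • q.2))
          ∂((μ.restrict K).prod (μ.restrict K)) := by
        rw [← lintegral_const_mul _ hm3.lintegral_prod_right',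
          lintegral_prod _ (hm3.lintegral_prod_right'.const_mul _).aemeasurable]
    _ = D ^ 2 * ∫⁻ t in Icc (0 : ℝ) 1, ∫⁻ x in K, ∫⁻ y in K,
          g ((1 - t) • x + t • y) ∂μ ∂μ := by
        rw [lintegral_lintegral_swap hm3.aemeasurable]
        congr 1
        refine lintegral_congr fun t => ?_
        rw [lintegral_prod _ (hm2 t).aemeasurable]
    _ ≤ D ^ 2 * ∫⁻ t in Icc (0 : ℝ) 1, 2 ^ Module.finrank ℝ E * μ K * ∫⁻ x, g x ∂μ := by
        gcongr 1
        exact setLIntegral_mono' measurableSet_Icc hslice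
    _ = _ := by
        rw [setLIntegral_const, Real.volume_Icc, hgint]
        simp [mul_assoc]

/-- If neighbouring values of `f` are at distance at most `s`, then any two values are at distance
at most the total of `s`. -/
theorem edist_sq_le_card_mul_sum_of_preconnected {V E : Type*} [Fintype V] [PseudoEMetricSpace E]
    {G : SimpleGraph V} (hG : G.Preconnected) {f : V → E} {s : V → ℝ≥0∞}
    (h : ∀ a b, G.Adj a b → edist (f a) (f b) ^ 2 ≤ s a) (a b : V) :
    edist (f a) (f b) ^ 2 ≤ Fintype.card V * ∑ w, s w := by
  classical
  set σ : V → ℝ≥0∞ := fun w => s w ^ (1 / 2 : ℝ) with hσ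
  have hσ2 : ∀ w, σ w ^ 2 = s w := fun w => by
    rw [hσ, ← ENNReal.rpow_two, ← ENNReal.rpow_mul]; norm_num
  have hadj : ∀ a b, G.Adj a b → edist (f a) (f b) ≤ σ a := fun a b hab => by
    rw [← ENNReal.pow_le_pow_left_iff two_ne_zero, hσ2]
    exact h a b hab
  have hwalk : ∀ {a b : V} (p : G.Walk a b),
      edist (f a) (f b) ≤ (p.support.map σ).sum := by
    intro a b p
    induction p with
    | nil => simp
    | cons hab p ih =>
      rw [SimpleGraph.Walk.support_cons, List.map_cons, List.sum_cons]
      exact (edist_triangle _ _ _).trans (add_le_add (hadj _ _ hab) ih)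
  obtain ⟨p, hp⟩ := (hG a b).exists_isPath
  have hle : edist (f a) (f b) ≤ ∑ w, σ w := by
    refine (hwalk p).trans ?_
    rw [← List.sum_toFinset σ hp.support_nodup]
    exact Finset.sum_le_sum_of_subset (Finset.subset_univ _)
  calc edist (f a) (f b) ^ 2 ≤ (∑ w, σ w) ^ 2 := by gcongr
    _ ≤ Fintype.card V * ∑ w, σ w ^ 2 := by
      have := ENNReal.rpow_sum_le_const_mul_sum_rpow Finset.univ σ one_le_two
      norm_num at this
      simpa using this
    _ = _ := by simp_rw [hσ2]

section Cubes

variable {d : ℕ} {r : ℝ}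

/-- The closed cube of sidelength `r` centered at `r·z`. -/
def closedCube (d : ℕ) (r : ℝ) (z : Fin d → ℤ) : Set (EuclideanSpace ℝ (Fin d)) :=
  {x | ∀ i, r * (z i : ℝ) - r / 2 ≤ x i ∧ x i ≤ r * (z i : ℝ) + r / 2}

/-- The interior of the smallest box containing the cubes centered at `r·z` and `r·w`. -/
def openBox (d : ℕ) (r : ℝ) (z w : Fin d → ℤ) : Set (EuclideanSpace ℝ (Fin d)) :=
  {x | ∀ i, r * (min (z i) (w i) : ℤ) - r / 2 < x i ∧ x i < r * (max (z i) (w i) : ℤ) + r / 2}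

theorem isClosed_closedCube (z : Fin d → ℤ) : IsClosed (closedCube d r z) := by
  simp only [closedCube, ofPred_forall, ofPred_and]
  exact isClosed_iInter fun i => (isClosed_le (by fun_prop) (by fun_prop)).inter
    (isClosed_le (by fun_prop) (by fun_prop))

theorem isOpen_openBox (z w : Fin d → ℤ) : IsOpen (openBox d r z w) := by
  simp only [openBox, ofPred_forall, ofPred_and]
  exact isOpen_iInter_of_finite fun i => (isOpen_lt (by fun_prop) (by fun_prop)).inter
    (isOpen_lt (by fun_prop) (by fun_prop))

theorem measurableSet_smallCube (z : Fin d → ℤ) : MeasurableSet (smallCube d r z) := by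
  simp only [smallCube, ofPred_forall, ofPred_and]
  exact MeasurableSet.iInter fun i => (measurableSet_le (by fun_prop) (by fun_prop)).inter
    (measurableSet_lt (by fun_prop) (by fun_prop))

theorem convex_openBox (z w : Fin d → ℤ) : Convex ℝ (openBox d r z w) := by
  have : openBox d r z w = ⋂ i, (EuclideanSpace.proj (𝕜 := ℝ) i) ⁻¹'
      Ioo (r * (min (z i) (w i) : ℤ) - r / 2) (r * (max (z i) (w i) : ℤ) + r / 2) := by
    ext x; simp [openBox]
  rw [this]
  exact convex_iInter fun i => (convex_Ioo _ _).linear_preimage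
    (EuclideanSpace.proj (𝕜 := ℝ) i).toLinearMap

theorem smallCube_subset_closedCube (z : Fin d → ℤ) : smallCube d r z ⊆ closedCube d r z :=
  fun _ hx i => ⟨(hx i).1, (hx i).2.le⟩

theorem closure_smallCube_subset (z : Fin d → ℤ) :
    closure (smallCube d r z) ⊆ closedCube d r z :=
  closure_minimal (smallCube_subset_closedCube z) (isClosed_closedCube z)

theorem openBox_self_subset_smallCube (z : Fin d → ℤ) :
    openBox d r z z ⊆ smallCube d r z := fun x hx i => by
  have := hx i
  rw [min_self, max_self] at this
  exact ⟨this.1.le, this.2⟩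

theorem openBox_self_left_subset (hr : 0 < r) (z w : Fin d → ℤ) :
    openBox d r z z ⊆ openBox d r z w := fun x hx i => by
  have := hx i
  rw [min_self, max_self] at this
  have h1 : ((min (z i) (w i) : ℤ) : ℝ) ≤ z i := by exact_mod_cast min_le_left _ _
  have h2 : (z i : ℝ) ≤ (max (z i) (w i) : ℤ) := by exact_mod_cast le_max_left _ _
  constructor <;> nlinarith

theorem openBox_comm (z w : Fin d → ℤ) : openBox d r z w = openBox d r w z := by
  simp only [openBox, min_comm, max_comm]

theorem exists_mem_smallCube (hr : 0 < r) (x : EuclideanSpace ℝ (Fin d)) :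
    ∃ z, x ∈ smallCube d r z := by
  refine ⟨fun i => ⌊x i / r + 1 / 2⌋, fun i => ?_⟩
  have h1 := Int.floor_le (x i / r + 1 / 2)
  have h2 := Int.lt_floor_add_one (x i / r + 1 / 2)
  have hx : x i = r * (x i / r) := by field_simp
  constructor <;> nlinarith

theorem pairwise_disjoint_smallCube (hr : 0 < r) :
    Pairwise (Function.onFun Disjoint (smallCube d r)) := by
  intro z w hzw
  refine disjoint_left.2 fun x hz hw => hzw (funext fun i => ?_)
  have key : ∀ a b : ℤ, r * (a : ℝ) - r / 2 ≤ x i → x i < r * (b : ℝ) + r / 2 → a ≤ b := by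
    intro a b ha hb
    have : (a : ℝ) < b + 1 := by
      by_contra! hcon
      nlinarith
    exact Int.lt_add_one_iff.1 (by exact_mod_cast this)
  exact le_antisymm (key _ _ (hz i).1 (hw i).2) (key _ _ (hw i).1 (hz i).2)

theorem eq_of_mem_openBox_of_mem_closedCube (hr : 0 < r) {z w : Fin d → ℤ}
    {x : EuclideanSpace ℝ (Fin d)} (hz : x ∈ openBox d r z z) (hw : x ∈ closedCube d r w) :
    z = w := by
  refine funext fun i => ?_
  have h := hz i
  rw [min_self, max_self] at h
  have hw := hw i
  have h1 : (z i : ℝ) < w i + 1 := by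
    by_contra! hcon
    nlinarith
  have h2 : (w i : ℝ) < z i + 1 := by
    by_contra! hcon
    nlinarith
  exact le_antisymm (Int.lt_add_one_iff.1 (by exact_mod_cast h1))
    (Int.lt_add_one_iff.1 (by exact_mod_cast h2))

theorem le_add_one_of_mem_closedCube (hr : 0 < r) {z w : Fin d → ℤ}
    {x : EuclideanSpace ℝ (Fin d)} (hz : x ∈ closedCube d r z) (hw : x ∈ closedCube d r w)
    (i : Fin d) : z i ≤ w i + 1 := by
  have h : (z i : ℝ) ≤ w i + 1 := by
    by_contra! hcon
    nlinarith [(hz i).1, (hw i).2]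
  exact_mod_cast h

theorem mem_Icc_of_mem_openBox_of_mem_smallCube (hr : 0 < r) {z w u : Fin d → ℤ}
    {x : EuclideanSpace ℝ (Fin d)} (h : x ∈ openBox d r z w) (hu : x ∈ smallCube d r u)
    (i : Fin d) : min (z i) (w i) ≤ u i ∧ u i ≤ max (z i) (w i) := by
  have h := h i
  have hu := hu i
  generalize min (z i) (w i) = m at *
  generalize max (z i) (w i) = M at *
  have h1 : (m : ℝ) < u i + 1 := by
    by_contra! hcon
    nlinarith
  have h2 : (u i : ℝ) < M + 1 := by
    by_contra! hcon
    nlinarith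
  exact ⟨Int.lt_add_one_iff.1 (by exact_mod_cast h1),
    Int.lt_add_one_iff.1 (by exact_mod_cast h2)⟩

theorem mem_closedCube_of_forall_eq_or_eq {z w u : Fin d → ℤ} {x : EuclideanSpace ℝ (Fin d)}
    (hz : x ∈ closedCube d r z) (hw : x ∈ closedCube d r w) (h : ∀ i, u i = z i ∨ u i = w i) :
    x ∈ closedCube d r u := fun i => by
  rcases h i with h | h <;> rw [h]
  exacts [hz i, hw i]

theorem finite_setOf_smallCube_inter_nonempty (hr : 0 < r) {U : Set (EuclideanSpace ℝ (Fin d))}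
    (hU : Bornology.IsBounded U) : {z : Fin d → ℤ | (smallCube d r z ∩ U).Nonempty}.Finite := by
  obtain ⟨R, hR⟩ := hU.exists_norm_le
  refine (finite_Icc (fun _ => ⌊-R / r - 1⌋) (fun _ => ⌈R / r + 1⌉)).subset ?_
  rintro z ⟨x, hxz, hxU⟩
  have hx : ∀ i, |x i| ≤ R := fun i => (PiLp.norm_apply_le x i).trans (hR x hxU)
  have hRr : R = r * (R / r) := by field_simp
  constructor <;> intro i
  · refine Int.floor_le_iff.2 ?_
    have := (abs_le.1 (hx i)).1
    have h2 := (hxz i).2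
    rw [neg_div]
    by_contra! hcon
    nlinarith
  · refine Int.le_ceil_iff.2 ?_
    have := (abs_le.1 (hx i)).2
    have h2 := (hxz i).1
    by_contra! hcon
    nlinarith

theorem volume_smallCube (z : Fin d → ℤ) :
    volume (smallCube d r z) = ENNReal.ofReal r ^ d := by
  have h : smallCube d r z = WithLp.ofLp ⁻¹' (univ.pi fun i =>
      Ico (r * (z i : ℝ) - r / 2) (r * (z i : ℝ) + r / 2)) := by
    ext x; simp [smallCube]
  rw [h, (PiLp.volume_preserving_ofLp (Fin d)).measure_preimage
    (MeasurableSet.univ_pi fun i => measurableSet_Ico).nullMeasurableSet, Real.volume_pi_Ico]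
  simp

theorem volume_openBox (z w : Fin d → ℤ) : volume (openBox d r z w) =
    ∏ i, ENNReal.ofReal (r * (max (z i) (w i) : ℤ) - r * (min (z i) (w i) : ℤ) + r) := by
  have h : openBox d r z w = WithLp.ofLp ⁻¹' (univ.pi fun i =>
      Ioo (r * (min (z i) (w i) : ℤ) - r / 2) (r * (max (z i) (w i) : ℤ) + r / 2)) := by
    ext x; simp [openBox]
  rw [h, (PiLp.volume_preserving_ofLp (Fin d)).measure_preimage
    (MeasurableSet.univ_pi fun i => measurableSet_Ioo).nullMeasurableSet, Real.volume_pi_Ioo]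
  refine Finset.prod_congr rfl fun i _ => ?_
  congr 1
  ring

theorem volume_openBox_self (z : Fin d → ℤ) :
    volume (openBox d r z z) = ENNReal.ofReal r ^ d := by
  simp [volume_openBox]

theorem openBox_self_ae_eq_smallCube (z : Fin d → ℤ) :
    openBox d r z z =ᵐ[volume] smallCube d r z :=
  ae_eq_of_subset_of_measure_ge (openBox_self_subset_smallCube z)
    (by rw [volume_smallCube, volume_openBox_self])
    (isOpen_openBox z z).measurableSet.nullMeasurableSet
    (by rw [volume_smallCube]; exact ENNReal.pow_ne_top ENNReal.ofReal_ne_top)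

theorem max_sub_min_le_one (hr : 0 < r) {z w : Fin d → ℤ} {x : EuclideanSpace ℝ (Fin d)}
    (hz : x ∈ closedCube d r z) (hw : x ∈ closedCube d r w) (i : Fin d) :
    max (z i) (w i) ≤ min (z i) (w i) + 1 := by
  have h1 := le_add_one_of_mem_closedCube hr hz hw i
  have h2 := le_add_one_of_mem_closedCube hr hw hz i
  omega

theorem volume_openBox_le (hr : 0 < r) {z w : Fin d → ℤ} {x : EuclideanSpace ℝ (Fin d)}
    (hz : x ∈ closedCube d r z) (hw : x ∈ closedCube d r w) :
    volume (openBox d r z w) ≤ 2 ^ d * ENNReal.ofReal r ^ d := by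
  rw [volume_openBox, ← mul_pow]
  refine (Finset.prod_le_pow_card _ _ (2 * ENNReal.ofReal r) fun i _ => ?_).trans (by simp)
  rw [← ENNReal.ofReal_ofNat 2, ← ENNReal.ofReal_mul zero_le_two]
  refine ENNReal.ofReal_le_ofReal ?_
  have h : ((max (z i) (w i) : ℤ) : ℝ) ≤ (min (z i) (w i) : ℤ) + 1 := by
    exact_mod_cast max_sub_min_le_one hr hz hw i
  nlinarith

theorem enorm_sub_le_of_mem_openBox (hr : 0 < r) {z w : Fin d → ℤ}
    {p : EuclideanSpace ℝ (Fin d)} (hz : p ∈ closedCube d r z) (hw : p ∈ closedCube d r w)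
    {x y : EuclideanSpace ℝ (Fin d)} (hx : x ∈ openBox d r z w) (hy : y ∈ openBox d r z w) :
    ‖y - x‖ₑ ≤ 2 * d * ENNReal.ofReal r := by
  have hi : ∀ i, ‖(y - x) i‖ ≤ 2 * r := fun i => by
    have h : ((max (z i) (w i) : ℤ) : ℝ) ≤ (min (z i) (w i) : ℤ) + 1 := by
      exact_mod_cast max_sub_min_le_one hr hz hw i
    have hx := hx i
    have hy := hy i
    rw [PiLp.sub_apply, Real.norm_eq_abs, abs_le]
    constructor <;> nlinarith
  have hn : ‖y - x‖ ≤ 2 * d * r := by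
    rw [EuclideanSpace.norm_eq, Real.sqrt_le_left (by positivity)]
    calc ∑ i, ‖(y - x) i‖ ^ 2 ≤ ∑ _i : Fin d, (2 * r) ^ 2 := by gcongr with i; exact hi i
      _ = d * (2 * r) ^ 2 := by simp
      _ ≤ (d * d : ℕ) * (2 * r) ^ 2 := by gcongr; exact Nat.le_mul_self d
      _ = (2 * d * r) ^ 2 := by push_cast; ring
  rw [← ofReal_norm]
  refine (ENNReal.ofReal_le_ofReal hn).trans_eq ?_
  rw [ENNReal.ofReal_mul (by positivity), ENNReal.ofReal_mul zero_le_two]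
  simp

end Cubes

section CubicSet

variable {d : ℕ} {r : ℝ} {U : Set (EuclideanSpace ℝ (Fin d))}

/-- Every cube whose closure contains a point of the cubic set meets `U`. -/
theorem smallCube_inter_nonempty_of_mem_cubicSet (hr : 0 < r) {x : EuclideanSpace ℝ (Fin d)}
    (hx : x ∈ cubicSet d r U) {w : Fin d → ℤ} (hw : x ∈ closedCube d r w) :
    (smallCube d r w ∩ U).Nonempty := by
  set c : EuclideanSpace ℝ (Fin d) := WithLp.toLp 2 fun i => r * (w i : ℝ) with hc
  set p : ℝ → EuclideanSpace ℝ (Fin d) := fun t => (1 - t) • x + t • c with hp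
  have hpc : Continuous p := by fun_prop
  have hp0 : p 0 = x := by simp [hp]
  have hev : ∀ᶠ t in nhdsWithin 0 (Ioi (0 : ℝ)), p t ∈ cubicSet d r U :=
    (hpc.tendsto 0).mono_left nhdsWithin_le_nhds
      (isOpen_interior.mem_nhds (by rw [hp0]; exact hx))
  obtain ⟨t, hpt, ht0, ht1⟩ := (hev.and (Ioo_mem_nhdsGT (zero_lt_one' ℝ))).exists
  have hbox : p t ∈ openBox d r w w := fun i => by
    have h := hw i
    have hpi : p t i = (1 - t) * x i + t * (r * w i) := by simp [hp, hc]
    rw [min_self, max_self, hpi]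
    constructor <;> nlinarith
  obtain ⟨z, hz, hpz⟩ := mem_iUnion₂.1 (interior_subset hpt)
  rw [eq_of_mem_openBox_of_mem_closedCube hr hbox (closure_smallCube_subset z hpz)]
  exact hz

theorem openBox_self_subset_cubicSet {z : Fin d → ℤ} (hz : (smallCube d r z ∩ U).Nonempty) :
    openBox d r z z ⊆ cubicSet d r U :=
  interior_maximal (((openBox_self_subset_smallCube z).trans subset_closure).trans
    (subset_biUnion_of_mem (u := fun z => closure (smallCube d r z)) hz)) (isOpen_openBox z z)

theorem openBox_subset_cubicSet (hr : 0 < r) {z w : Fin d → ℤ} {p : EuclideanSpace ℝ (Fin d)}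
    (hp : p ∈ cubicSet d r U) (hz : p ∈ closedCube d r z) (hw : p ∈ closedCube d r w) :
    openBox d r z w ⊆ cubicSet d r U := by
  refine interior_maximal (fun x hx => ?_) (isOpen_openBox z w)
  obtain ⟨u, hu⟩ := exists_mem_smallCube hr x
  refine mem_iUnion₂.2 ⟨u, ?_, subset_closure hu⟩
  refine smallCube_inter_nonempty_of_mem_cubicSet hr hp
    (mem_closedCube_of_forall_eq_or_eq hz hw fun i => ?_)
  have h1 := mem_Icc_of_mem_openBox_of_mem_smallCube hr hx hu i
  have h2 := max_sub_min_le_one hr hz hw i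
  omega

theorem cubicSet_subset_iUnion_smallCube (hr : 0 < r) : cubicSet d r U ⊆
    ⋃ z : {z : Fin d → ℤ // (smallCube d r z ∩ U).Nonempty}, smallCube d r z.1 := fun x hx => by
  obtain ⟨u, hu⟩ := exists_mem_smallCube hr x
  exact mem_iUnion.2 ⟨⟨u, smallCube_inter_nonempty_of_mem_cubicSet hr hx
    (smallCube_subset_closedCube u hu)⟩, hu⟩

/-- Cubes meeting `U` are neighbours when their closures share a point of the cubic set. -/
def cubeGraph (d : ℕ) (r : ℝ) (U : Set (EuclideanSpace ℝ (Fin d))) :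
    SimpleGraph {z : Fin d → ℤ // (smallCube d r z ∩ U).Nonempty} where
  Adj z w := z ≠ w ∧ ∃ x ∈ cubicSet d r U, x ∈ closedCube d r z.1 ∧ x ∈ closedCube d r w.1
  symm := ⟨fun _ _ ⟨h, x, hx, hz, hw⟩ => ⟨h.symm, x, hx, hw, hz⟩⟩
  loopless := ⟨fun _ h => h.1 rfl⟩

theorem openBox_self_nonempty (hr : 0 < r) (z : Fin d → ℤ) : (openBox d r z z).Nonempty :=
  ⟨WithLp.toLp 2 fun i => r * (z i : ℝ), fun i => by
    rw [min_self, max_self]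
    constructor <;> simp [hr]⟩

theorem preconnected_cubeGraph (hr : 0 < r) (hU : Bornology.IsBounded U)
    (hconn : IsPreconnected (cubicSet d r U)) : (cubeGraph d r U).Preconnected := by
  have : Finite {z : Fin d → ℤ // (smallCube d r z ∩ U).Nonempty} :=
    (finite_setOf_smallCube_inter_nonempty hr hU).to_subtype
  intro a b
  by_contra hab
  set A := {z | (cubeGraph d r U).Reachable a z} with hA
  have hclosed : ∀ S : Set {z : Fin d → ℤ // (smallCube d r z ∩ U).Nonempty},
      IsClosed (⋃ z ∈ S, closedCube d r z.1) := fun S =>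
    S.toFinite.isClosed_biUnion fun z _ => isClosed_closedCube z.1
  have hne : ∀ (S : Set {z : Fin d → ℤ // (smallCube d r z ∩ U).Nonempty}) (z), z ∈ S →
      (cubicSet d r U ∩ ⋃ z ∈ S, closedCube d r z.1).Nonempty := by
    intro S z hz
    obtain ⟨x, hx⟩ := openBox_self_nonempty (d := d) hr z.1
    exact ⟨x, openBox_self_subset_cubicSet z.2 hx, mem_iUnion₂.2 ⟨z, hz,
      smallCube_subset_closedCube _ (openBox_self_subset_smallCube _ hx)⟩⟩
  have hcover : cubicSet d r U ⊆
      (⋃ z ∈ A, closedCube d r z.1) ∪ ⋃ z ∈ Aᶜ, closedCube d r z.1 := by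
    intro x hx
    obtain ⟨z, hz⟩ := mem_iUnion.1 (cubicSet_subset_iUnion_smallCube hr hx)
    have hz := smallCube_subset_closedCube _ hz
    by_cases hzA : z ∈ A
    · exact Or.inl (mem_iUnion₂.2 ⟨z, hzA, hz⟩)
    · exact Or.inr (mem_iUnion₂.2 ⟨z, hzA, hz⟩)
  obtain ⟨x, hxW, hxA, hxB⟩ := isPreconnected_closed_iff.1 hconn _ _ (hclosed A) (hclosed Aᶜ)
    hcover (hne A a (SimpleGraph.Reachable.refl a)) (hne Aᶜ b hab)
  obtain ⟨z, hz, hxz⟩ := mem_iUnion₂.1 hxA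
  obtain ⟨w, hw, hxw⟩ := mem_iUnion₂.1 hxB
  refine hw (SimpleGraph.Reachable.trans hz (SimpleGraph.Adj.reachable ⟨?_, x, hxW, hxz, hxw⟩))
  rintro rfl
  exact hw hz

/-- The shifts between a cube of the tessellation and the cubes touching it. -/
noncomputable def neighborShifts (d : ℕ) : Finset (Fin d → ℤ) := Fintype.piFinset fun _ => Finset.Icc (-1) 1

theorem card_neighborShifts (d : ℕ) : (neighborShifts d).card = 3 ^ d := by
  simp [neighborShifts]

theorem setLIntegral_openBox_le (hr : 0 < r) {z w : Fin d → ℤ} {p : EuclideanSpace ℝ (Fin d)}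
    (hp : p ∈ cubicSet d r U) (hz : p ∈ closedCube d r z) (hw : p ∈ closedCube d r w)
    (g : EuclideanSpace ℝ (Fin d) → ℝ≥0∞) :
    ∫⁻ x in openBox d r z w, g x ≤
      ∑ k ∈ neighborShifts d, ∫⁻ x in cubicSet d r U ∩ smallCube d r (z + k), g x := by
  have hsub : openBox d r z w ⊆
      ⋃ k : neighborShifts d, cubicSet d r U ∩ smallCube d r (z + k) := by
    intro x hx
    obtain ⟨u, hu⟩ := exists_mem_smallCube hr x
    refine mem_iUnion.2 ⟨⟨u - z, ?_⟩, openBox_subset_cubicSet hr hp hz hw hx, by simpa using hu⟩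
    refine Fintype.mem_piFinset.2 fun i => Finset.mem_Icc.2 ?_
    have h1 := mem_Icc_of_mem_openBox_of_mem_smallCube hr hx hu i
    have h2 := max_sub_min_le_one hr hz hw i
    rw [Pi.sub_apply]
    omega
  refine (lintegral_mono_set hsub).trans ((lintegral_iUnion_le _ _).trans_eq ?_)
  rw [tsum_fintype]
  exact Finset.sum_coe_sort (neighborShifts d)
    fun k => ∫⁻ x in cubicSet d r U ∩ smallCube d r (z + k), g x

theorem sum_neighborShifts_setLIntegral_le (hr : 0 < r)
    [Fintype {z : Fin d → ℤ // (smallCube d r z ∩ U).Nonempty}]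
    (g : EuclideanSpace ℝ (Fin d) → ℝ≥0∞) :
    ∑ z : {z : Fin d → ℤ // (smallCube d r z ∩ U).Nonempty}, ∑ k ∈ neighborShifts d,
      ∫⁻ x in cubicSet d r U ∩ smallCube d r (z.1 + k), g x ≤
    3 ^ d * ∫⁻ x in cubicSet d r U, g x := by
  rw [Finset.sum_comm]
  have hk : ∀ k ∈ neighborShifts d,
      ∑ z : {z : Fin d → ℤ // (smallCube d r z ∩ U).Nonempty},
        ∫⁻ x in cubicSet d r U ∩ smallCube d r (z.1 + k), g x ≤
      ∫⁻ x in cubicSet d r U, g x := by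
    intro k _
    rw [← tsum_fintype (L := .unconditional _), ← lintegral_iUnion]
    · exact lintegral_mono_set (iUnion_subset fun _ => inter_subset_left)
    · exact fun z => isOpen_interior.measurableSet.inter (measurableSet_smallCube _)
    · intro z w hzw
      refine (pairwise_disjoint_smallCube hr fun h => hzw ?_).mono inter_subset_right
        inter_subset_right
      exact Subtype.ext (add_right_cancel h)
  refine (Finset.sum_le_card_nsmul _ _ _ hk).trans_eq ?_
  rw [card_neighborShifts, nsmul_eq_mul]
  push_cast
  rfl

end CubicSet

theorem enorm_add_sq_le {E : Type*} [NormedAddCommGroup E] (a b : E) :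
    ‖a + b‖ₑ ^ 2 ≤ 2 * (‖a‖ₑ ^ 2 + ‖b‖ₑ ^ 2) := by
  have h := ENNReal.rpow_add_le_mul_rpow_add_rpow ‖a‖ₑ ‖b‖ₑ one_le_two
  norm_num at h
  exact (pow_le_pow_left' (enorm_add_le a b) 2).trans h

section Poincare

variable {d : ℕ} {r : ℝ} {U : Set (EuclideanSpace ℝ (Fin d))}
  {v : EuclideanSpace ℝ (Fin d) → EuclideanSpace ℝ (Fin d)}

/-- Poincaré inequality on the box spanned by two touching cubes. -/
theorem lintegral_openBox_enorm_sub_sq_le (hr : 0 < r) {z w : Fin d → ℤ}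
    {p : EuclideanSpace ℝ (Fin d)} (hz : p ∈ closedCube d r z) (hw : p ∈ closedCube d r w)
    (hv : ∀ x ∈ openBox d r z w, DifferentiableAt ℝ v x) :
    ∫⁻ x in openBox d r z w, ∫⁻ y in openBox d r z w, ‖v y - v x‖ₑ ^ 2 ≤
      ((2 * d) ^ 2 * 4 ^ d) * ENNReal.ofReal r ^ 2 * ENNReal.ofReal r ^ d *
        ∫⁻ x in openBox d r z w, ‖fderiv ℝ v x‖ₑ ^ 2 := by
  refine ((convex_openBox z w).lintegral_lintegral_enorm_sub_sq_le volume
    (isOpen_openBox z w).measurableSet hv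
    fun x hx y hy => enorm_sub_le_of_mem_openBox hr hz hw hx hy).trans ?_
  rw [finrank_euclideanSpace_fin]
  gcongr ?_ * _
  calc (2 * (d : ℝ≥0∞) * ENNReal.ofReal r) ^ 2 * 2 ^ d * volume (openBox d r z w)
      ≤ (2 * (d : ℝ≥0∞) * ENNReal.ofReal r) ^ 2 * 2 ^ d * (2 ^ d * ENNReal.ofReal r ^ d) := by
        gcongr
        exact volume_openBox_le hr hz hw
    _ = ((2 * d) ^ 2 * (2 * 2) ^ d) * ENNReal.ofReal r ^ 2 * ENNReal.ofReal r ^ d := by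
        rw [mul_pow, mul_pow 2 2]; ring
    _ = _ := by norm_num

theorem exists_lintegral_enorm_sub_sq_le {α E : Type*} [MeasurableSpace α] {μ : Measure α}
    [NormedAddCommGroup E] [MeasurableSpace E] [BorelSpace E] [SecondCountableTopology E]
    {v : α → E} (hv : Measurable v) {s : Set α} (h0 : μ s ≠ 0) (htop : μ s ≠ ∞) :
    ∃ b : E, μ s * ∫⁻ y in s, ‖v y - b‖ₑ ^ 2 ∂μ ≤
      ∫⁻ x in s, ∫⁻ y in s, ‖v y - v x‖ₑ ^ 2 ∂μ ∂μ := by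
  have : SFinite (μ.restrict s) :=
    have : IsFiniteMeasure (μ.restrict s) := ⟨by simpa using htop.lt_top⟩
    inferInstance
  have hm : Measurable fun x => ∫⁻ y in s, ‖v y - v x‖ₑ ^ 2 ∂μ :=
    Measurable.lintegral_prod_right'
      (f := fun q : α × α => ‖v q.2 - v q.1‖ₑ ^ 2) (by fun_prop)
  obtain ⟨x, _, hx⟩ := exists_le_setLAverage h0 htop hm.aemeasurable
  refine ⟨v x, ?_⟩
  rw [setLAverage_eq] at hx
  calc _ ≤ μ s * ((∫⁻ x in s, ∫⁻ y in s, ‖v y - v x‖ₑ ^ 2 ∂μ ∂μ) / μ s) := by gcongr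
    _ = _ := ENNReal.mul_div_cancel h0 htop

theorem measure_mul_measure_mul_enorm_sub_sq_le {α E : Type*} [MeasurableSpace α]
    {μ : Measure α} [SFinite μ]
    [NormedAddCommGroup E] [MeasurableSpace E] [BorelSpace E] [SecondCountableTopology E]
    {v : α → E} (hv : Measurable v) (s t : Set α) (b c : E) :
    μ s * μ t * ‖b - c‖ₑ ^ 2 ≤ 4 * (μ t * ∫⁻ x in s, ‖v x - b‖ₑ ^ 2 ∂μ +
      ∫⁻ x in s, ∫⁻ y in t, ‖v y - v x‖ₑ ^ 2 ∂μ ∂μ + μ s * ∫⁻ y in t, ‖v y - c‖ₑ ^ 2 ∂μ) := by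
  have hpt : ∀ x y, ‖b - c‖ₑ ^ 2 ≤
      4 * (‖v x - b‖ₑ ^ 2 + ‖v y - v x‖ₑ ^ 2 + ‖v y - c‖ₑ ^ 2) := by
    intro x y
    have h1 := enorm_add_sq_le (b - v x + (v x - v y)) (v y - c)
    have h2 := enorm_add_sq_le (b - v x) (v x - v y)
    rw [sub_add_sub_cancel, sub_add_sub_cancel] at h1
    rw [sub_add_sub_cancel] at h2
    rw [enorm_sub_rev b (v x), enorm_sub_rev (v x) (v y)] at h2
    calc ‖b - c‖ₑ ^ 2 ≤ 2 * (‖b - v y‖ₑ ^ 2 + ‖v y - c‖ₑ ^ 2) := h1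
      _ ≤ 2 * (2 * (‖v x - b‖ₑ ^ 2 + ‖v y - v x‖ₑ ^ 2) + 2 * ‖v y - c‖ₑ ^ 2) := by
        gcongr 2 * ?_
        refine add_le_add h2 ?_
        rw [two_mul]
        exact le_self_add
      _ = _ := by ring
  have hm : Measurable fun x => ∫⁻ y in t, ‖v y - v x‖ₑ ^ 2 ∂μ :=
    Measurable.lintegral_prod_right'
      (f := fun q : α × α => ‖v q.2 - v q.1‖ₑ ^ 2) (by fun_prop)
  calc μ s * μ t * ‖b - c‖ₑ ^ 2 = ∫⁻ _ in s, ∫⁻ _ in t, ‖b - c‖ₑ ^ 2 ∂μ ∂μ := by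
        rw [setLIntegral_const, setLIntegral_const]; ring
    _ ≤ ∫⁻ x in s, ∫⁻ y in t,
          4 * (‖v x - b‖ₑ ^ 2 + ‖v y - v x‖ₑ ^ 2 + ‖v y - c‖ₑ ^ 2) ∂μ ∂μ :=
        lintegral_mono fun x => lintegral_mono fun y => hpt x y
    _ = ∫⁻ x in s, 4 * (‖v x - b‖ₑ ^ 2 * μ t + ∫⁻ y in t, ‖v y - v x‖ₑ ^ 2 ∂μ +
          ∫⁻ y in t, ‖v y - c‖ₑ ^ 2 ∂μ) ∂μ := by
        refine lintegral_congr fun x => ?_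
        rw [lintegral_const_mul _ (by fun_prop), lintegral_add_left (by fun_prop),
          lintegral_add_left (by fun_prop), setLIntegral_const]
    _ = _ := by
        rw [lintegral_const_mul _ (by fun_prop), lintegral_add_left (by fun_prop),
          lintegral_add_left (by fun_prop), setLIntegral_const,
          lintegral_mul_const _ (by fun_prop)]
        ring

/-- Poincaré inequality on cubic sets, for extended nonnegative integrals. -/
theorem exists_lintegral_cubicSet_enorm_sub_sq_le (hr : 0 < r) (hU : Bornology.IsBounded U)
    (hconn : IsConnected (cubicSet d r U)) (hvm : Measurable v)
    (hv : ∀ x ∈ cubicSet d r U, DifferentiableAt ℝ v x) :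
    ∃ b, ∫⁻ x in cubicSet d r U, ‖v x - b‖ₑ ^ 2 ≤
      (26 * ((2 * d) ^ 2 * 4 ^ d) * 3 ^ d) * ENNReal.ofReal r ^ 2 * (numCubes d r U : ℝ≥0∞) ^ 2 *
        ∫⁻ x in cubicSet d r U, ‖fderiv ℝ v x‖ₑ ^ 2 := by
  have : Finite {z : Fin d → ℤ // (smallCube d r z ∩ U).Nonempty} :=
    (finite_setOf_smallCube_inter_nonempty hr hU).to_subtype
  have := Fintype.ofFinite {z : Fin d → ℤ // (smallCube d r z ∩ U).Nonempty}
  obtain ⟨x₀, hx₀⟩ := hconn.nonempty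
  obtain ⟨z₀, -⟩ := mem_iUnion.1 (cubicSet_subset_iUnion_smallCube hr hx₀)
  set g : EuclideanSpace ℝ (Fin d) → ℝ≥0∞ := fun x => ‖fderiv ℝ v x‖ₑ ^ 2 with hg
  set W := cubicSet d r U with hW
  set G := ∫⁻ x in W, g x with hG
  set R := ENNReal.ofReal r with hR
  set c : ℝ≥0∞ := (2 * d) ^ 2 * 4 ^ d with hc
  set N : ℝ≥0∞ := (numCubes d r U : ℝ≥0∞) with hN
  have hcard : (Fintype.card {z : Fin d → ℤ // (smallCube d r z ∩ U).Nonempty} : ℝ≥0∞) = N := by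
    rw [hN, numCubes, Nat.card_eq_fintype_card]
  have hN1 : 1 ≤ N := by
    rw [← hcard]
    exact_mod_cast Fintype.card_pos_iff.2 ⟨z₀⟩
  have hR0 : R ^ d ≠ 0 := pow_ne_zero _ (by simpa [hR] using hr)
  have hRtop : R ^ d ≠ ∞ := ENNReal.pow_ne_top ENNReal.ofReal_ne_top
  set e : {z : Fin d → ℤ // (smallCube d r z ∩ U).Nonempty} → ℝ≥0∞ := fun z =>
    ∑ k ∈ neighborShifts d, ∫⁻ x in W ∩ smallCube d r (z.1 + k), g x with he
  have hesum : ∑ z, e z ≤ 3 ^ d * G := sum_neighborShifts_setLIntegral_le hr g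
  have hcenter : ∀ z : {z : Fin d → ℤ // (smallCube d r z ∩ U).Nonempty},
      ∃ p ∈ W, p ∈ closedCube d r z.1 := fun z => by
    obtain ⟨p, hp⟩ := openBox_self_nonempty (d := d) hr z.1
    exact ⟨p, openBox_self_subset_cubicSet z.2 hp,
      smallCube_subset_closedCube _ (openBox_self_subset_smallCube _ hp)⟩
  have hbox : ∀ (z : {z : Fin d → ℤ // (smallCube d r z ∩ U).Nonempty}) (w : Fin d → ℤ),
      (∃ p ∈ W, p ∈ closedCube d r z.1 ∧ p ∈ closedCube d r w) →
      ∫⁻ x in openBox d r z w, ∫⁻ y in openBox d r z w, ‖v y - v x‖ₑ ^ 2 ≤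
        c * R ^ 2 * R ^ d * e z := by
    rintro z w ⟨p, hp, hz, hw⟩
    refine (lintegral_openBox_enorm_sub_sq_le hr hz hw
      fun x hx => hv x (openBox_subset_cubicSet hr hp hz hw hx)).trans ?_
    gcongr
    exact setLIntegral_openBox_le hr hp hz hw g
  choose b hb using fun z : {z : Fin d → ℤ // (smallCube d r z ∩ U).Nonempty} =>
    exists_lintegral_enorm_sub_sq_le (μ := volume) hvm (s := openBox d r z z)
      (by rwa [volume_openBox_self]) (by rwa [volume_openBox_self])
  simp only [volume_openBox_self] at hb
  have hP : ∀ z : {z : Fin d → ℤ // (smallCube d r z ∩ U).Nonempty},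
      ∫⁻ x in openBox d r z.1 z, ‖v x - b z‖ₑ ^ 2 ≤ c * R ^ 2 * e z := fun z => by
    obtain ⟨p, hp, hpz⟩ := hcenter z
    rw [← ENNReal.mul_le_mul_iff_right hR0 hRtop]
    refine ((hb z).trans (hbox z z ⟨p, hp, hpz, hpz⟩)).trans_eq ?_
    ring
  have hadj : ∀ z w, (cubeGraph d r U).Adj z w →
      edist (b z) (b w) ^ 2 ≤ 12 * c * R ^ 2 * (R ^ d)⁻¹ * e z := by
    rintro z w ⟨-, hp⟩
    have hmono : ∀ {s t : Set (EuclideanSpace ℝ (Fin d))}, s ⊆ openBox d r z.1 w →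
        t ⊆ openBox d r z.1 w → ∫⁻ x in s, ∫⁻ y in t, ‖v y - v x‖ₑ ^ 2 ≤
          c * R ^ 2 * R ^ d * e z := fun hs ht =>
      ((lintegral_mono fun x => lintegral_mono_set ht).trans (lintegral_mono_set hs)).trans
        (hbox z w hp)
    have hsz := openBox_self_left_subset hr z.1 w.1
    have hsw := openBox_self_left_subset hr w.1 z.1
    rw [openBox_comm w.1 z.1] at hsw
    have h := measure_mul_measure_mul_enorm_sub_sq_le (μ := volume) hvm
      (openBox d r z.1 z) (openBox d r w.1 w) (b z) (b w)
    simp only [volume_openBox_self] at h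
    rw [← ENNReal.mul_le_mul_iff_right hR0 hRtop, ← ENNReal.mul_le_mul_iff_right hR0 hRtop,
      edist_eq_enorm_sub, ← mul_assoc]
    refine h.trans ?_
    calc _ ≤ 4 * (c * R ^ 2 * R ^ d * e z + c * R ^ 2 * R ^ d * e z + c * R ^ 2 * R ^ d * e z) := by
          gcongr 4 * ?_
          exact add_le_add (add_le_add ((hb z).trans (hmono hsz hsz)) (hmono hsz hsw))
            ((hb w).trans (hmono hsw hsw))
      _ = R ^ d * (R ^ d)⁻¹ * (12 * c * R ^ 2 * R ^ d * e z) := by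
          rw [ENNReal.mul_inv_cancel hR0 hRtop]; ring
      _ = _ := by ring
  have hchain : ∀ z, R ^ d * ‖b z - b z₀‖ₑ ^ 2 ≤ N * (12 * c * R ^ 2 * (3 ^ d * G)) := fun z => by
    have h := edist_sq_le_card_mul_sum_of_preconnected
      (preconnected_cubeGraph hr hU hconn.isPreconnected) hadj z z₀
    rw [edist_eq_enorm_sub, ← Finset.mul_sum, hcard] at h
    calc R ^ d * ‖b z - b z₀‖ₑ ^ 2
        ≤ R ^ d * (N * (12 * c * R ^ 2 * (R ^ d)⁻¹ * (3 ^ d * G))) := by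
          gcongr
          exact h.trans (by gcongr)
      _ = R ^ d * (R ^ d)⁻¹ * (N * (12 * c * R ^ 2 * (3 ^ d * G))) := by ring
      _ = _ := by rw [ENNReal.mul_inv_cancel hR0 hRtop, one_mul]
  have hcube : ∀ z, ∫⁻ x in smallCube d r z.1, ‖v x - b z₀‖ₑ ^ 2 ≤
      2 * (c * R ^ 2 * e z + N * (12 * c * R ^ 2 * (3 ^ d * G))) := fun z => by
    rw [← setLIntegral_congr (openBox_self_ae_eq_smallCube z.1)]
    calc ∫⁻ x in openBox d r z.1 z, ‖v x - b z₀‖ₑ ^ 2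
        ≤ ∫⁻ x in openBox d r z.1 z, 2 * (‖v x - b z‖ₑ ^ 2 + ‖b z - b z₀‖ₑ ^ 2) :=
          lintegral_mono fun x => by
            simpa using enorm_add_sq_le (v x - b z) (b z - b z₀)
      _ = 2 * ((∫⁻ x in openBox d r z.1 z, ‖v x - b z‖ₑ ^ 2) +
            R ^ d * ‖b z - b z₀‖ₑ ^ 2) := by
          rw [lintegral_const_mul _ (by fun_prop), lintegral_add_left (by fun_prop),
            setLIntegral_const, volume_openBox_self, mul_comm (R ^ d)]
      _ ≤ _ := by
          gcongr 2 * ?_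
          exact add_le_add (hP z) (hchain z)
  refine ⟨b z₀, ?_⟩
  calc ∫⁻ x in W, ‖v x - b z₀‖ₑ ^ 2
      ≤ ∑ z : {z : Fin d → ℤ // (smallCube d r z ∩ U).Nonempty},
          ∫⁻ x in smallCube d r z.1, ‖v x - b z₀‖ₑ ^ 2 := by
        refine (lintegral_mono_set (cubicSet_subset_iUnion_smallCube hr)).trans ?_
        rw [← tsum_fintype (L := .unconditional _)]
        exact lintegral_iUnion_le _ _
    _ ≤ ∑ z, 2 * (c * R ^ 2 * e z + N * (12 * c * R ^ 2 * (3 ^ d * G))) :=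
        Finset.sum_le_sum fun z _ => hcube z
    _ = 2 * (c * R ^ 2 * ∑ z, e z + N * (N * (12 * c * R ^ 2 * (3 ^ d * G)))) := by
        rw [← Finset.mul_sum, Finset.sum_add_distrib, ← Finset.mul_sum, Finset.sum_const,
          Finset.card_univ, nsmul_eq_mul, hcard]
    _ ≤ 2 * (c * R ^ 2 * (N ^ 2 * (3 ^ d * G)) + N * (N * (12 * c * R ^ 2 * (3 ^ d * G)))) := by
        gcongr
        exact hesum.trans (le_mul_of_one_le_left' (one_le_pow₀ hN1))
    _ = _ := by ring

end Poincare

/-- Poincaré inequality on cubic sets: there is an absolute constant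
`C > 0` (independent of `U` and `r`) such that for every `v ∈ H¹((U)^r; ℝ^d)` there is
`b ∈ ℝ^d` with `r⁻² ∫ |v − b|² ≤ C (#𝒬_r(U))² ∫ |∇v|²`. -/
theorem poincare_on_cubic_sets (d : ℕ) (hd : 2 ≤ d) :
    ∃ C > (0:ℝ), ∀ (U : Set (EuclideanSpace ℝ (Fin d))), IsOpen U → Bornology.IsBounded U →
      ∀ r : ℝ, 0 < r → IsConnected (cubicSet d r U) →
      ∀ v : EuclideanSpace ℝ (Fin d) → EuclideanSpace ℝ (Fin d),
        DifferentiableOn ℝ v (cubicSet d r U) →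
        IntegrableOn (fun x => ‖v x‖^2) (cubicSet d r U) →
        IntegrableOn (fun x => ‖fderiv ℝ v x‖^2) (cubicSet d r U) →
        ∃ b : EuclideanSpace ℝ (Fin d),
          (∫ x in cubicSet d r U, ‖v x - b‖^2) / r^2
            ≤ C * (numCubes d r U : ℝ)^2 * ∫ x in cubicSet d r U, ‖fderiv ℝ v x‖^2 := by
  classical
  refine ⟨26 * ((2 * d) ^ 2 * 4 ^ d) * 3 ^ d, by positivity, ?_⟩
  intro U _ hU r hr hconn v hv _ hgrad
  set W := cubicSet d r U with hW
  have hWo : IsOpen W := isOpen_interior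
  set u := W.indicator v with hu
  have huv : ∀ x ∈ W, u =ᶠ[nhds x] v := fun x hx =>
    Filter.mem_of_superset (hWo.mem_nhds hx) fun y hy => indicator_of_mem hy v
  have hum : Measurable u := by
    rw [hu, ← piecewise_eq_indicator]
    exact hv.continuousOn.measurable_piecewise continuousOn_const hWo.measurableSet
  obtain ⟨b, hb⟩ := exists_lintegral_cubicSet_enorm_sub_sq_le hr hU hconn hum
    fun x hx => ((hv x hx).differentiableAt (hWo.mem_nhds hx)).congr_of_eventuallyEq (huv x hx)
  refine ⟨b, ?_⟩
  have hl : ∫⁻ x in W, ‖u x - b‖ₑ ^ 2 = ∫⁻ x in W, ‖v x - b‖ₑ ^ 2 :=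
    setLIntegral_congr_fun hWo.measurableSet fun x hx => by
      simp only [(huv x hx).eq_of_nhds]
  have hrg : ∫⁻ x in W, ‖fderiv ℝ u x‖ₑ ^ 2 = ∫⁻ x in W, ‖fderiv ℝ v x‖ₑ ^ 2 :=
    setLIntegral_congr_fun hWo.measurableSet fun x hx => by
      simp only [(huv x hx).fderiv_eq]
  have hvm : AEStronglyMeasurable v (volume.restrict W) :=
    hv.continuousOn.aestronglyMeasurable hWo.measurableSet
  have hint : ∀ {E : Type} [NormedAddCommGroup E] (f : EuclideanSpace ℝ (Fin d) → E),
      AEStronglyMeasurable (fun x => ‖f x‖ ^ 2) (volume.restrict W) →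
      ∫ x in W, ‖f x‖ ^ 2 = (∫⁻ x in W, ‖f x‖ₑ ^ 2).toReal := by
    intro E _ f hf
    rw [integral_eq_lintegral_of_nonneg_ae (Filter.Eventually.of_forall fun x => sq_nonneg _) hf]
    simp_rw [ENNReal.ofReal_pow (norm_nonneg _), ofReal_norm]
  have hfin : ∫⁻ x in W, ‖fderiv ℝ v x‖ₑ ^ 2 ≠ ∞ := by
    have := hgrad.2.ne
    simpa [enorm_pow] using this
  rw [hl, hrg] at hb
  rw [hint (fun x => v x - b) ((hvm.sub aestronglyMeasurable_const).norm.pow 2),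
    hint (fun x => fderiv ℝ v x) hgrad.1, div_le_iff₀ (by positivity)]
  have hC : (26 * ((2 * d) ^ 2 * 4 ^ d) * 3 ^ d : ℝ≥0∞) ≠ ∞ := by
    exact_mod_cast ENNReal.natCast_ne_top (26 * ((2 * d) ^ 2 * 4 ^ d) * 3 ^ d)
  refine (ENNReal.toReal_mono ?_ hb).trans_eq ?_
  · finiteness
  · simp only [ENNReal.toReal_mul, ENNReal.toReal_pow, ENNReal.toReal_ofReal hr.le,
      ENNReal.toReal_natCast, ENNReal.toReal_ofNat]
    ring
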